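/- For every n ≥ 1, the canonical map Glob(S^{n-1}) → Glob(D^n) induced by the inclusion of the unit sphere S^{n-1} = {x ∈ ℝ^n : ‖x‖ = 1} into the closed unit disk D^n = {x ∈ ℝ^n : ‖x‖ ≤ 1} (i.e. the unique map sending q(x,t) to q(x,t)) is well defined, continuous, injective, a closed topological embedding, and an order embedding: for a, b ∈ Glob(S^{n-1}), a ≤ b in Glob(S^{n-1}) if and only if the images of a and b satisfy ≤ in Glob(D^n). -/

import Mathlib

universe u

/-- The relation on `X × [0,1]` identifying `(x,0) ∼ (x',0)` and `(x,1) ∼ (x',1)`. -/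
def globR (X : Type u) : X × unitInterval → X × unitInterval → Prop :=
  fun p q => (p.2 = 0 ∧ q.2 = 0) ∨ (p.2 = 1 ∧ q.2 = 1)

/-- The Globe of a topological space `X` : the quotient of `X × [0,1]` by the
identifications `(x,0) ∼ (x',0)` and `(x,1) ∼ (x',1)`. -/
def Glob (X : Type u) : Type u := Quot (globR X)

/-- The quotient topology on `Glob X`. -/
instance (X : Type u) [TopologicalSpace X] : TopologicalSpace (Glob X) :=
  TopologicalSpace.coinduced (Quot.mk (globR X)) inferInstance

/-- The quotient map `q : X × [0,1] → Glob X`. -/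
def globQ {X : Type u} (p : X × unitInterval) : Glob X := Quot.mk (globR X) p

/-- The relation `≤` on `Glob X` : `a ≤ b` iff there are `x ∈ X` and `t ≤ t'` in `[0,1]`
with `a = q(x,t)` and `b = q(x,t')`. -/
def globLe {X : Type u} (a b : Glob X) : Prop :=
  ∃ (x : X) (t t' : unitInterval), t ≤ t' ∧ a = globQ (x, t) ∧ b = globQ (x, t')

open Topology

/-- The closed unit disk `D^n` in `ℝ^n`. -/
abbrev Disk (n : ℕ) : Type := {x : EuclideanSpace ℝ (Fin n) // ‖x‖ ≤ 1}

/-- The unit sphere `S^{n-1}` in `ℝ^n`. -/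
abbrev Sphere (n : ℕ) : Type := {x : EuclideanSpace ℝ (Fin n) // ‖x‖ = 1}

/-- The inclusion `S^{n-1} ⊂ D^n`. -/
def sphereIncl (n : ℕ) : Sphere n → Disk n := fun x => ⟨x.1, le_of_eq x.2⟩

theorem globQ_eq_globQ_iff {X : Type u} {p p' : X × unitInterval} :
    globQ p = globQ p' ↔ p.2 = p'.2 ∧ (p.1 = p'.1 ∨ p.2 = 0 ∨ p.2 = 1) := by
  constructor
  · intro h
    have h' := Quot.eqvGen_exact h
    clear h
    induction h' with
    | rel a b h => rcases h with ⟨h, h'⟩ | ⟨h, h'⟩ <;> simp [h, h']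
    | refl a => simp
    | symm a b _ ih => grind
    | trans a b c _ _ ih ih' => grind
  · rintro ⟨h, h' | h' | h'⟩
    · exact congrArg globQ (Prod.ext h' h)
    · exact Quot.sound (Or.inl ⟨h', h ▸ h'⟩)
    · exact Quot.sound (Or.inr ⟨h', h ▸ h'⟩)

theorem globQ_surjective {X : Type u} : Function.Surjective (globQ (X := X)) :=
  Quot.mk_surjective

theorem isQuotientMap_globQ {X : Type u} [TopologicalSpace X] :
    IsQuotientMap (globQ (X := X)) :=
  ⟨⟨rfl⟩, globQ_surjective⟩

/-- The map `Glob X → Glob Y` induced by `f : X → Y`. -/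
def globMap {X Y : Type u} (f : X → Y) : Glob X → Glob Y :=
  Quot.map (Prod.map f id) fun _ _ h => h

theorem globMap_globQ {X Y : Type u} (f : X → Y) (p : X × unitInterval) :
    globMap f (globQ p) = globQ (f p.1, p.2) := rfl

theorem continuous_globMap {X Y : Type u} [TopologicalSpace X] [TopologicalSpace Y] {f : X → Y}
    (hf : Continuous f) : Continuous (globMap f) :=
  isQuotientMap_globQ.continuous_iff.2 <|
    isQuotientMap_globQ.continuous.comp (hf.prodMap continuous_id)

theorem globMap_injective {X Y : Type u} {f : X → Y} (hf : Function.Injective f) :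
    Function.Injective (globMap f) := by
  intro a b h
  obtain ⟨p, rfl⟩ := globQ_surjective a
  obtain ⟨p', rfl⟩ := globQ_surjective b
  simpa only [globMap_globQ, globQ_eq_globQ_iff, hf.eq_iff] using h

/-- The saturation of the image of a saturated set adds at most the two ends of the cylinder. -/
theorem preimage_image_globMap {X Y : Type u} (f : X → Y) (A : Set (Glob X)) :
    globQ ⁻¹' (globMap f '' A) = Prod.map f id '' (globQ ⁻¹' A) ∪
      ({p | p.2 = 0} ∩ {_p | ∃ x, globQ (x, 0) ∈ A} ∪
        {p | p.2 = 1} ∩ {_p | ∃ x, globQ (x, 1) ∈ A}) := by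
  ext ⟨y, t⟩
  constructor
  · rintro ⟨a, ha, h⟩
    obtain ⟨⟨x, s⟩, rfl⟩ := globQ_surjective a
    rw [globMap_globQ, globQ_eq_globQ_iff] at h
    obtain ⟨rfl, h⟩ := h
    rcases h with rfl | rfl | rfl
    · exact Or.inl ⟨(x, s), ha, rfl⟩
    · exact Or.inr (Or.inl ⟨rfl, x, ha⟩)
    · exact Or.inr (Or.inr ⟨rfl, x, ha⟩)
  · rintro (⟨p, hp, h⟩ | ⟨h, x, hx⟩ | ⟨h, x, hx⟩)
    · exact ⟨globQ p, hp, congrArg globQ h⟩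
    · exact ⟨_, hx, globQ_eq_globQ_iff.2 ⟨Eq.symm h, Or.inr (Or.inl rfl)⟩⟩
    · exact ⟨_, hx, globQ_eq_globQ_iff.2 ⟨Eq.symm h, Or.inr (Or.inr rfl)⟩⟩

theorem isClosedEmbedding_globMap {X Y : Type u} [TopologicalSpace X] [TopologicalSpace Y]
    {f : X → Y} (hf : IsClosedEmbedding f) : IsClosedEmbedding (globMap f) := by
  refine .of_continuous_injective_isClosedMap (continuous_globMap hf.continuous)
    (globMap_injective hf.injective) fun A hA => ?_
  rw [← isQuotientMap_globQ.isClosed_preimage, preimage_image_globMap]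
  have hA' := (hf.prodMap IsClosedEmbedding.id).isClosedMap _
    (hA.preimage isQuotientMap_globQ.continuous)
  exact hA'.union
    (((isClosed_eq continuous_snd continuous_const).inter isClosed_const).union
      ((isClosed_eq continuous_snd continuous_const).inter isClosed_const))

theorem globLe_globMap_iff {X Y : Type u} {f : X → Y} (hf : Function.Injective f)
    {a b : Glob X} : globLe (globMap f a) (globMap f b) ↔ globLe a b := by
  constructor
  · rintro ⟨y, t, t', htt', ha, hb⟩
    obtain ⟨⟨x, s⟩, rfl⟩ := globQ_surjective a
    obtain ⟨⟨x', s'⟩, rfl⟩ := globQ_surjective b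
    rw [globMap_globQ, globQ_eq_globQ_iff] at ha hb
    obtain ⟨rfl, ha⟩ := ha
    obtain ⟨rfl, hb⟩ := hb
    rcases ha with ha | ha
    · refine ⟨x, s, s', htt', rfl, globQ_eq_globQ_iff.2 ⟨rfl, hb.imp_left fun hb => ?_⟩⟩
      exact hf (hb.trans ha.symm)
    · exact ⟨x', s, s', htt', globQ_eq_globQ_iff.2 ⟨rfl, Or.inr ha⟩, rfl⟩
  · rintro ⟨x, t, t', htt', rfl, rfl⟩
    exact ⟨f x, t, t', htt', rfl, rfl⟩

theorem isClosedEmbedding_sphereIncl (n : ℕ) : IsClosedEmbedding (sphereIncl n) := by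
  have h : IsClosedEmbedding (Subtype.val : Sphere n → EuclideanSpace ℝ (Fin n)) :=
    (isClosed_eq continuous_norm continuous_const).isClosedEmbedding_subtypeVal
  have h' : IsClosedEmbedding (Subtype.val : Disk n → EuclideanSpace ℝ (Fin n)) :=
    (isClosed_le continuous_norm continuous_const).isClosedEmbedding_subtypeVal
  exact h'.of_comp_iff.1 h

/-- for every `n ≥ 1`, the canonical map
`Glob(S^{n-1}) → Glob(D^n)` induced by the inclusion `S^{n-1} ⊂ D^n`
(the unique map sending `q(x,t)` to `q(x,t)`) is well defined, continuous, injective,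
a closed topological embedding, and an order embedding. -/
theorem stmt_2 (n : ℕ) (hn : 1 ≤ n) :
    ∃ F : Glob (Sphere n) → Glob (Disk n),
      (∀ (x : Sphere n) (t : unitInterval), F (globQ (x, t)) = globQ (sphereIncl n x, t)) ∧
      (∀ F' : Glob (Sphere n) → Glob (Disk n),
        (∀ (x : Sphere n) (t : unitInterval),
          F' (globQ (x, t)) = globQ (sphereIncl n x, t)) → F' = F) ∧
      Continuous F ∧
      Function.Injective F ∧
      IsClosedEmbedding F ∧
      (∀ a b : Glob (Sphere n), globLe a b ↔ globLe (F a) (F b)) := by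
  have hi := isClosedEmbedding_sphereIncl n
  have hF := isClosedEmbedding_globMap hi
  refine ⟨globMap (sphereIncl n), fun _ _ => rfl, fun F' hF' => ?_, hF.continuous, hF.injective,
    hF, fun a b => (globLe_globMap_iff hi.injective).symm⟩
  funext a
  obtain ⟨⟨x, t⟩, rfl⟩ := globQ_surjective a
  exact hF' x t
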